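/- arXiv:1507.01115 — 2 statements merged into one kernel-verified Lean document; each statement's English description precedes it below -/
import Mathlib

section
/- Let Z be a holomorphic vector field on ℂⁿ with entire components, let f₁, …, f_p be entire functions that are Darboux functions for Z, i.e. there exist entire functions g₁, …, g_p (the cofactors) with Z(f_k) = g_k·f_k for each k, and let m₁, …, m_p be natural numbers such that Σ_{k=1}^p m_k·g_k = −div Z identically. Then α = Π_{k=1}^p f_k^{m_k} is a holomorphic last multiplier for Z, i.e. Z(α) + α·div Z = 0 identically on ℂⁿ. -/
open scoped BigOperators

variable {n : ℕ}

/-- Partial derivative ∂f/∂z^i of a function on ℂⁿ. -/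
noncomputable def pd (f : (Fin n → ℂ) → ℂ) (i : Fin n) (z : Fin n → ℂ) : ℂ :=
  fderiv ℂ f z (Pi.single i 1)

/-- Holomorphic divergence div Z = Σ_k ∂Z^k/∂z^k. -/
noncomputable def hdiv (Z : (Fin n → ℂ) → (Fin n → ℂ)) (z : Fin n → ℂ) : ℂ :=
  ∑ k, pd (fun w => Z w k) k z

/-- Holomorphic last multiplier: Z(α) + α · div Z = 0. -/
def IsHLM (Z : (Fin n → ℂ) → (Fin n → ℂ)) (α : (Fin n → ℂ) → ℂ) : Prop :=
  ∀ z, (∑ k, Z z k * pd α k z) + α z * hdiv Z z = 0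

/-- Real divergence: trace over ℝ of the real Fréchet derivative. -/
noncomputable def rdiv (X : (Fin n → ℂ) → (Fin n → ℂ)) (z : Fin n → ℂ) : ℝ :=
  LinearMap.trace ℝ (Fin n → ℂ) (fderiv ℝ X z : (Fin n → ℂ) →ₗ[ℝ] (Fin n → ℂ))

/-- Real last multiplier: (Dᵣu)(X) + u · divᵣ X = 0. -/
def IsRLM (X : (Fin n → ℂ) → (Fin n → ℂ)) (u : (Fin n → ℂ) → ℝ) : Prop :=
  ∀ z, fderiv ℝ u z (X z) + u z * rdiv X z = 0

/-- ∂u/∂x^i for real-valued u. -/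
noncomputable def px (u : (Fin n → ℂ) → ℝ) (i : Fin n) (z : Fin n → ℂ) : ℝ :=
  fderiv ℝ u z (Pi.single i 1)

/-- ∂u/∂x^{n+i} for real-valued u. -/
noncomputable def py (u : (Fin n → ℂ) → ℝ) (i : Fin n) (z : Fin n → ℂ) : ℝ :=
  fderiv ℝ u z (Pi.single i Complex.I)

/-- Lie bracket of two vector fields. -/
noncomputable def lie (Z W : (Fin n → ℂ) → (Fin n → ℂ)) (z : Fin n → ℂ) : Fin n → ℂ :=
  fderiv ℂ W z (Z z) - fderiv ℂ Z z (W z)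

/-- Holomorphic Laplacian Δu = Σ_i ∂²u/∂(z^i)². -/
noncomputable def lap (f : (Fin n → ℂ) → ℂ) (z : Fin n → ℂ) : ℂ :=
  ∑ i, pd (pd f i) i z

/-- The sum Σ_k v^k ∂f/∂z^k is the Fréchet derivative of f along v. -/
lemma sum_mul_pd (f : (Fin n → ℂ) → ℂ) (v z : Fin n → ℂ) :
    ∑ k, v k * pd f k z = fderiv ℂ f z v := by
  conv_rhs => rw [pi_eq_sum_univ' v, map_sum]
  refine Finset.sum_congr rfl fun k _ => ?_
  rw [map_smul, smul_eq_mul, pd]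

section Darboux

variable {E : Type*} [NormedAddCommGroup E] [NormedSpace ℂ E]

lemma fderiv_pow_apply_of_darboux {f : E → ℂ} {z v : E} {c : ℂ}
    (hf : DifferentiableAt ℂ f z) (h : fderiv ℂ f z v = c * f z) (m : ℕ) :
    fderiv ℂ (fun w => f w ^ m) z v = m * c * f z ^ m := by
  rw [(hf.hasFDerivAt.pow m).fderiv]
  cases m with
  | zero => simp
  | succ m =>
    simp [h]
    ring

lemma fderiv_prod_apply_of_darboux {ι : Type*} (s : Finset ι) {f : ι → E → ℂ} {z v : E}
    {c : ι → ℂ} (hf : ∀ i, DifferentiableAt ℂ (f i) z)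
    (h : ∀ i, fderiv ℂ (f i) z v = c i * f i z) :
    fderiv ℂ (fun w => ∏ i ∈ s, f i w) z v = (∑ i ∈ s, c i) * ∏ i ∈ s, f i z := by
  classical
  rw [(HasFDerivAt.finsetProd fun i _ => (hf i).hasFDerivAt).fderiv]
  simp only [sum_apply, smul_apply, smul_eq_mul, h,
    Finset.sum_mul]
  refine Finset.sum_congr rfl fun i hi => ?_
  rw [← Finset.mul_prod_erase s _ hi]
  ring

end Darboux

/-- If f₁,…,f_p are Darboux functions for Z with cofactors g₁,…,g_p and
Σ_k m_k g_k = −div Z, then α = Π_k f_k^{m_k} is a holomorphic last multiplier for Z. -/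
theorem last_multiplier_of_darboux {p : ℕ}
    (Z : (Fin n → ℂ) → (Fin n → ℂ)) (hZ : ∀ z, AnalyticAt ℂ Z z)
    (f g : Fin p → (Fin n → ℂ) → ℂ)
    (hf : ∀ k z, AnalyticAt ℂ (f k) z) (hg : ∀ k z, AnalyticAt ℂ (g k) z)
    (hDarboux : ∀ k z, (∑ j, Z z j * pd (f k) j z) = g k z * f k z)
    (m : Fin p → ℕ)
    (hsum : ∀ z, ∑ k, (m k : ℂ) * g k z = -hdiv Z z) :
    IsHLM Z (fun z => ∏ k, f k z ^ m k) := by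
  intro z
  have hd : ∀ k, DifferentiableAt ℂ (f k) z := fun k => (hf k z).differentiableAt
  rw [sum_mul_pd, fderiv_prod_apply_of_darboux Finset.univ (fun k => (hd k).fun_pow (m k))
    (fun k => fderiv_pow_apply_of_darboux (hd k)
      ((sum_mul_pd (f k) (Z z) z).symm.trans (hDarboux k z)) (m k)), hsum]
  ring
end

section
/- Let P = (P^{ij}) be an antisymmetric n×n matrix of entire functions on ℂⁿ, and let f, α be entire functions. Then α is a holomorphic last multiplier for the holomorphic Hamiltonian vector field Z_f (i.e. Z_f(α) + α·div Z_f = 0 identically) if and only if α·Σ_{i=1}^n P^i (∂f/∂z^i) = Σ_{i,j=1}^n P^{ij} (∂α/∂z^i)(∂f/∂z^j) identically, where P^i = Σ_j ∂P^{ij}/∂z^j; equivalently, f is a holomorphic first integral of the vector field α·Z_ω − Z_α, where Z_ω = (P^1, …, P^n) is the modular vector field and Z_α is the Hamiltonian vector field of α. -/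
open scoped BigOperators

variable {n : ℕ}

theorem pd_mul {u v : (Fin n → ℂ) → ℂ} {z : Fin n → ℂ} (hu : DifferentiableAt ℂ u z)
    (hv : DifferentiableAt ℂ v z) (k : Fin n) :
    pd (fun w => u w * v w) k z = pd u k z * v z + u z * pd v k z := by
  simp only [pd, fderiv_fun_mul hu hv, add_apply, smul_apply, smul_eq_mul]
  ring

theorem pd_sum {u : Fin n → (Fin n → ℂ) → ℂ} {z : Fin n → ℂ}
    (hu : ∀ i, DifferentiableAt ℂ (u i) z) (k : Fin n) :
    pd (fun w => ∑ i, u i w) k z = ∑ i, pd (u i) k z := by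
  simp [pd, fderiv_fun_sum fun i _ => hu i]

theorem differentiableAt_pd {f : (Fin n → ℂ) → ℂ} {z : Fin n → ℂ} (hf : AnalyticAt ℂ f z)
    (i : Fin n) : DifferentiableAt ℂ (pd f i) z :=
  hf.fderiv.differentiableAt.clm_apply (differentiableAt_const _)

/-- Mixed partial derivatives of a holomorphic function commute. -/
theorem pd_pd_comm {f : (Fin n → ℂ) → ℂ} {z : Fin n → ℂ} (hf : AnalyticAt ℂ f z)
    (i j : Fin n) : pd (pd f i) j z = pd (pd f j) i z := by
  have pd_pd_apply (i j : Fin n) :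
      pd (pd f i) j z = fderiv ℂ (fderiv ℂ f) z (Pi.single j 1) (Pi.single i 1) := by
    change fderiv ℂ (fun w => fderiv ℂ f w (Pi.single i 1)) z (Pi.single j 1) = _
    rw [fderiv_clm_apply hf.fderiv.differentiableAt (differentiableAt_const _)]
    simp
  rw [pd_pd_apply, pd_pd_apply]
  exact (hf.contDiffAt (n := ⊤)).isSymmSndFDerivAt (by simp) _ _

/-- An antisymmetric array contracts to zero with a symmetric one. -/
theorem sum_antisymm_mul_symm_eq_zero {A S : Fin n → Fin n → ℂ}
    (hA : ∀ i j, A i j = -A j i) (hS : ∀ i j, S i j = S j i) :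
    ∑ j, ∑ i, A i j * S i j = 0 := by
  have h : ∑ j, ∑ i, A i j * S i j = -∑ j, ∑ i, A i j * S i j := by
    conv_lhs => rw [Finset.sum_comm]
    simp only [← Finset.sum_neg_distrib]
    refine Finset.sum_congr rfl fun i _ => Finset.sum_congr rfl fun j _ => ?_
    rw [hA i j, hS i j, neg_mul]
  exact self_eq_neg.mp h

/-- The divergence of a Hamiltonian field `Z_f` is the modular field applied to `f`. -/
theorem hdiv_hamiltonian {P : (Fin n → ℂ) → Matrix (Fin n) (Fin n) ℂ} {f : (Fin n → ℂ) → ℂ}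
    {z : Fin n → ℂ} (hP : ∀ i j, DifferentiableAt ℂ (fun w => P w i j) z)
    (hPanti : ∀ i j, P z i j = -P z j i) (hf : AnalyticAt ℂ f z) :
    hdiv (fun w j => ∑ i, P w i j * pd f i w) z =
      ∑ i, (∑ j, pd (fun w => P w i j) j z) * pd f i z := by
  have hdf := differentiableAt_pd hf
  simp only [hdiv]
  simp_rw [pd_sum fun i => (hP i _).fun_mul (hdf i), pd_mul (hP _ _) (hdf _),
    Finset.sum_add_distrib]
  rw [sum_antisymm_mul_symm_eq_zero hPanti (pd_pd_comm hf), add_zero, Finset.sum_comm]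
  simp_rw [Finset.sum_mul]

/-- α is a holomorphic last multiplier for the Hamiltonian field Z_f iff
α·Σ_i P^i ∂f/∂z^i = Σ_{i,j} P^{ij} (∂α/∂z^i)(∂f/∂z^j); equivalently, f is a holomorphic first
integral of α·Z_ω − Z_α. -/
theorem last_multiplier_hamiltonian_iff
    (P : (Fin n → ℂ) → Matrix (Fin n) (Fin n) ℂ)
    (hP : ∀ i j z, AnalyticAt ℂ (fun w => P w i j) z)
    (hPanti : ∀ z i j, P z i j = -P z j i)
    (f α : (Fin n → ℂ) → ℂ)
    (hf : ∀ z, AnalyticAt ℂ f z) (hα : ∀ z, AnalyticAt ℂ α z) :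
    (IsHLM (fun w j => ∑ i, P w i j * pd f i w) α ↔
      ∀ z, α z * (∑ i, (∑ j, pd (fun w => P w i j) j z) * pd f i z) =
        ∑ i, ∑ j, P z i j * pd α i z * pd f j z) ∧
    (IsHLM (fun w j => ∑ i, P w i j * pd f i w) α ↔
      ∀ z, (∑ k, (α z * (∑ j, pd (fun w => P w k j) j z) -
        ∑ i, P z i k * pd α i z) * pd f k z) = 0) := by
  have hmult (z : Fin n → ℂ) : ∑ k, (∑ i, P z i k * pd f i z) * pd α k z =
      -∑ i, ∑ j, P z i j * pd α i z * pd f j z := by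
    simp_rw [Finset.sum_mul, ← Finset.sum_neg_distrib]
    refine Finset.sum_congr rfl fun k _ => Finset.sum_congr rfl fun i _ => ?_
    rw [hPanti z i k]
    ring
  have hfirst (z : Fin n → ℂ) :
      ∑ k, (α z * (∑ j, pd (fun w => P w k j) j z) - ∑ i, P z i k * pd α i z) * pd f k z =
        α z * (∑ i, (∑ j, pd (fun w => P w i j) j z) * pd f i z) -
          ∑ i, ∑ j, P z i j * pd α i z * pd f j z := by
    rw [Finset.sum_comm (f := fun i j => P z i j * pd α i z * pd f j z), Finset.mul_sum,
      ← Finset.sum_sub_distrib]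
    refine Finset.sum_congr rfl fun k _ => ?_
    rw [sub_mul, Finset.sum_mul, mul_assoc]
  have hiff : IsHLM (fun w j => ∑ i, P w i j * pd f i w) α ↔
      ∀ z, α z * (∑ i, (∑ j, pd (fun w => P w i j) j z) * pd f i z) =
        ∑ i, ∑ j, P z i j * pd α i z * pd f j z := by
    refine forall_congr' fun z => ?_
    rw [hdiv_hamiltonian (fun i j => (hP i j z).differentiableAt) (hPanti z) (hf z), hmult,
      neg_add_eq_zero, eq_comm]
  refine ⟨hiff, hiff.trans (forall_congr' fun z => ?_)⟩
  rw [hfirst, sub_eq_zero]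
end
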